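/- arXiv:1207.5637 — 6 statements merged into one kernel-verified Lean document; each statement's English description precedes it below -/
import Mathlib

section
/- Let V be a real vector space and R : V × V × V × V → ℝ a quadrilinear map satisfying R(X,Y,W,U) = −R(Y,X,W,U) and R(X,Y,W,U) = R(W,U,X,Y) for all X,Y,W,U ∈ V. Let φ¹, φ² : V → ℝ be linear functionals and e₁, e₂ ∈ V with φⁱ(eⱼ) = δᵢⱼ. Assume that for i = 1, 2 and all X,Y,Z,W,U ∈ V: φⁱ(X)R(Y,Z,W,U) + φⁱ(Y)R(Z,X,W,U) + φⁱ(Z)R(X,Y,W,U) = 0. Then, setting c = R(e₁,e₂,e₁,e₂) and Ω(X,Y) = φ¹(X)φ²(Y) − φ¹(Y)φ²(X), one has R(X,Y,W,U) = c·Ω(X,Y)·Ω(W,U) for all X,Y,W,U ∈ V. -/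
/-!
Algebraic lemma: a quadrilinear map R with the symmetries of a curvature tensor
that is annihilated (in the wedge sense) by two functionals φ¹, φ² dual to
vectors e₁, e₂ equals c·Ω⊗Ω, where c = R(e₁,e₂,e₁,e₂) and Ω = φ¹∧φ².
-/

theorem curvature_rank_one
    (V : Type*) [AddCommGroup V] [Module ℝ V]
    (R : V →ₗ[ℝ] V →ₗ[ℝ] V →ₗ[ℝ] V →ₗ[ℝ] ℝ)
    (hanti : ∀ X Y W U : V, R X Y W U = -R Y X W U)
    (hpair : ∀ X Y W U : V, R X Y W U = R W U X Y)
    (φ1 φ2 : V →ₗ[ℝ] ℝ) (e1 e2 : V)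
    (h11 : φ1 e1 = 1) (h12 : φ1 e2 = 0) (h21 : φ2 e1 = 0) (h22 : φ2 e2 = 1)
    (hcyc1 : ∀ X Y Z W U : V,
      φ1 X * R Y Z W U + φ1 Y * R Z X W U + φ1 Z * R X Y W U = 0)
    (hcyc2 : ∀ X Y Z W U : V,
      φ2 X * R Y Z W U + φ2 Y * R Z X W U + φ2 Z * R X Y W U = 0) :
    ∀ X Y W U : V,
      R X Y W U = R e1 e2 e1 e2 * (φ1 X * φ2 Y - φ1 Y * φ2 X) *
        (φ1 W * φ2 U - φ1 U * φ2 W) := by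
  have wedge : ∀ X Y W U : V,
      R X Y W U = (φ1 X * φ2 Y - φ1 Y * φ2 X) * R e1 e2 W U := by
    intro X Y W U
    have he1 : ∀ Z : V, R e1 Z W U = φ2 Z * R e1 e2 W U := by
      intro Z
      have h := hcyc2 e2 e1 Z W U
      rw [h22, h21, hanti e2 e1] at h
      linarith
    have h := hcyc1 e1 X Y W U
    rw [h11, hanti Y e1, he1 X, he1 Y] at h
    linarith
  intro X Y W U
  rw [wedge X Y W U, hpair e1 e2 W U, wedge W U e1 e2]
  ring
end

section
/- Let V be a real vector space, J : V → V a linear map with J∘J = −id, and R : V × V × V × V → ℝ a quadrilinear map satisfying R(JX,JY,W,U) = R(X,Y,W,U) for all X,Y,W,U ∈ V. Let θ : V → ℝ be a linear functional such that for all X,Y,Z,W,U ∈ V: θ(X)R(Y,Z,W,U) + θ(Y)R(Z,X,W,U) + θ(Z)R(X,Y,W,U) = 0. Then also (θ∘J)(X)R(Y,Z,W,U) + (θ∘J)(Y)R(Z,X,W,U) + (θ∘J)(Z)R(X,Y,W,U) = 0 for all X,Y,Z,W,U ∈ V. -/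
/-!
If a quadrilinear map R satisfies R(JX,JY,W,U) = R(X,Y,W,U) for a complex
structure J (J² = −id) and θ ∧ R(·,·,W,U) = 0 (cyclic sum condition) for a
linear functional θ, then also (θ∘J) ∧ R(·,·,W,U) = 0.
-/

theorem thetaJ_wedge_R_vanishes
    (V : Type*) [AddCommGroup V] [Module ℝ V]
    (J : V →ₗ[ℝ] V) (hJ : ∀ X : V, J (J X) = -X)
    (R : V →ₗ[ℝ] V →ₗ[ℝ] V →ₗ[ℝ] V →ₗ[ℝ] ℝ)
    (hRJ : ∀ X Y W U : V, R (J X) (J Y) W U = R X Y W U)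
    (θ : V →ₗ[ℝ] ℝ)
    (hcyc : ∀ X Y Z W U : V,
      θ X * R Y Z W U + θ Y * R Z X W U + θ Z * R X Y W U = 0) :
    ∀ X Y Z W U : V,
      θ (J X) * R Y Z W U + θ (J Y) * R Z X W U + θ (J Z) * R X Y W U = 0 := by
  intro X Y Z W U
  simpa only [hRJ] using hcyc (J X) (J Y) (J Z) W U
end

section
/- Let V be a real vector space, g a nondegenerate symmetric bilinear form on V, and J₁, J₂, J₃ : V → V linear maps with J₁² = J₂² = J₃² = −id, J₁J₂ = J₃, and g(JₐX, JₐY) = g(X,Y) for a = 1,2,3 and all X,Y. Let R : V × V × V × V → ℝ be quadrilinear with R(X,Y,W,U) = −R(Y,X,W,U), R(X,Y,W,U) = R(W,U,X,Y), and R(JₐX,JₐY,W,U) = R(X,Y,W,U) for a = 1,2,3. Let ξ ∈ V, ξ ≠ 0, and set θ = g(·,ξ). If for all X,Y,Z,W,U ∈ V: θ(X)R(Y,Z,W,U) + θ(Y)R(Z,X,W,U) + θ(Z)R(X,Y,W,U) = 0, then R = 0. -/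
theorem quaternionic_curvature_vanishes
    (V : Type*) [AddCommGroup V] [Module ℝ V]
    (g : V →ₗ[ℝ] V →ₗ[ℝ] ℝ)
    (hsymm : ∀ X Y : V, g X Y = g Y X)
    (hnondeg : ∀ Y : V, (∀ X : V, g X Y = 0) → Y = 0)
    (J1 J2 J3 : V →ₗ[ℝ] V)
    (hJ1 : ∀ X : V, J1 (J1 X) = -X)
    (hJ2 : ∀ X : V, J2 (J2 X) = -X)
    (hJ3 : ∀ X : V, J3 (J3 X) = -X)
    (hJ12 : ∀ X : V, J1 (J2 X) = J3 X)
    (hg1 : ∀ X Y : V, g (J1 X) (J1 Y) = g X Y)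
    (hg2 : ∀ X Y : V, g (J2 X) (J2 Y) = g X Y)
    (hg3 : ∀ X Y : V, g (J3 X) (J3 Y) = g X Y)
    (R : V →ₗ[ℝ] V →ₗ[ℝ] V →ₗ[ℝ] V →ₗ[ℝ] ℝ)
    (hanti : ∀ X Y W U : V, R X Y W U = -R Y X W U)
    (hpair : ∀ X Y W U : V, R X Y W U = R W U X Y)
    (hRJ1 : ∀ X Y W U : V, R (J1 X) (J1 Y) W U = R X Y W U)
    (hRJ2 : ∀ X Y W U : V, R (J2 X) (J2 Y) W U = R X Y W U)
    (hRJ3 : ∀ X Y W U : V, R (J3 X) (J3 Y) W U = R X Y W U)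
    (ξ : V) (hξ : ξ ≠ 0)
    (hcyc : ∀ X Y Z W U : V,
      g X ξ * R Y Z W U + g Y ξ * R Z X W U + g Z ξ * R X Y W U = 0) :
    R = 0 := by
  have hJ21 : ∀ X, J2 (J1 X) = -J3 X := fun X => by
    have h : J3 (J3 (J2 X)) = -J2 X := hJ3 _
    rw [← hJ12 (J2 X), hJ2, map_neg, map_neg, neg_inj, ← hJ12] at h
    have h' := congrArg J1 h
    rw [hJ1, hJ12] at h'
    rw [← h', neg_neg]
  have hJ13 : ∀ X, J1 (J3 X) = -J2 X := fun X => by rw [← hJ12, hJ1]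
  have hJ23 : ∀ X, J2 (J3 X) = J1 X := fun X => by
    rw [← hJ12, hJ21, ← hJ12, hJ2, map_neg, neg_neg]
  have hJ31 : ∀ X, J3 (J1 X) = J2 X := fun X => by
    rw [← hJ12, hJ21, map_neg, hJ13, neg_neg]
  have hJ32 : ∀ X, J3 (J2 X) = -J1 X := fun X => by rw [← hJ12, hJ2, map_neg]
  -- A vector on which `θ = g(·, ξ)` is nonzero, with `θ` vanishing on its images under `Jₐ`.
  obtain ⟨A, hA, hA1, hA2, hA3⟩ : ∃ A : V, g A ξ ≠ 0 ∧ g (J1 A) ξ = 0 ∧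
      g (J2 A) ξ = 0 ∧ g (J3 A) ξ = 0 := by
    obtain ⟨B, hB⟩ : ∃ B, g B ξ ≠ 0 := by
      by_contra! h
      exact hξ (hnondeg ξ h)
    refine ⟨g B ξ • B + g (J1 B) ξ • J1 B + g (J2 B) ξ • J2 B + g (J3 B) ξ • J3 B,
      ?_, ?_, ?_, ?_⟩
    · simp only [map_add, map_smul, LinearMap.add_apply, LinearMap.smul_apply, smul_eq_mul]
      have := mul_self_pos.mpr hB
      nlinarith [mul_self_nonneg (g (J1 B) ξ), mul_self_nonneg (g (J2 B) ξ),
        mul_self_nonneg (g (J3 B) ξ)]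
    all_goals
      simp only [map_add, map_smul, LinearMap.add_apply, LinearMap.smul_apply, smul_eq_mul,
        hJ1, hJ2, hJ3, hJ12, hJ21, hJ13, hJ23, hJ31, hJ32, map_neg, LinearMap.neg_apply]
      ring
  have hker : ∀ Y Z W U, g Y ξ = 0 → g Z ξ = 0 → R Y Z W U = 0 := fun Y Z W U hY hZ => by
    simpa [hY, hZ, hA] using hcyc A Y Z W U
  have hAJ3 : ∀ W U, R A (J3 A) W U = 0 := fun W U => by
    have h := hker (J1 A) (J2 A) W U hA1 hA2
    rw [← hRJ1, hJ1, hJ12, hpair] at h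
    rw [hpair]
    simpa using h
  have hAZ : ∀ Z W U, R A Z W U = 0 := fun Z W U => by
    have h := hcyc A (J3 A) (J3 Z) W U
    simpa [hA3, hAJ3, hRJ3, hA] using h
  ext Y Z W U
  have h := hcyc A Y Z W U
  rw [hanti Z A, hAZ, hAZ] at h
  simpa [hA] using h
end

section
/- Let V be a real vector space, g a symmetric bilinear form on V, J : V → V a linear map with J∘J = −id and g(JX,JY) = g(X,Y) for all X,Y, and ξ ∈ V with g(ξ,ξ) = 0. Define S_X Y = g(X,Y)ξ − g(Y,ξ)X − g(X,JY)Jξ + g(JY,ξ)JX. Then for all X,Y,Z ∈ V: S_X(S_Y Z) − S_Y(S_X Z) − S_{S_X Y − S_Y X} Z = −2 g(X,JY)·(g(ξ,JZ)ξ + g(Z,ξ)Jξ). -/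
/-!
The tensor R^S of a strongly degenerate homogeneous pseudo-Kähler structure of
linear type: with S_X Y = g(X,Y)ξ − g(Y,ξ)X − g(X,JY)Jξ + g(JY,ξ)JX and ξ
isotropic, one has [S_X,S_Y]Z − S_{S_XY − S_YX}Z = −2g(X,JY)(g(ξ,JZ)ξ + g(Z,ξ)Jξ).
-/

noncomputable def Sop {V : Type*} [AddCommGroup V] [Module ℝ V]
    (g : V →ₗ[ℝ] V →ₗ[ℝ] ℝ) (J : V →ₗ[ℝ] V) (ξ : V) (X Y : V) : V :=
  g X Y • ξ - g Y ξ • X - g X (J Y) • J ξ + g (J Y) ξ • J X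

theorem RS_formula
    (V : Type*) [AddCommGroup V] [Module ℝ V]
    (g : V →ₗ[ℝ] V →ₗ[ℝ] ℝ)
    (hsymm : ∀ X Y : V, g X Y = g Y X)
    (J : V →ₗ[ℝ] V) (hJ : ∀ X : V, J (J X) = -X)
    (hgJ : ∀ X Y : V, g (J X) (J Y) = g X Y)
    (ξ : V) (hiso : g ξ ξ = 0) :
    ∀ X Y Z : V,
      Sop g J ξ X (Sop g J ξ Y Z) - Sop g J ξ Y (Sop g J ξ X Z)
        - Sop g J ξ (Sop g J ξ X Y - Sop g J ξ Y X) Z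
      = (-2 * g X (J Y)) • (g ξ (J Z) • ξ + g Z ξ • J ξ) := by
  intro X Y Z
  have skew : ∀ A B : V, g (J A) B = -g A (J B) := fun A B => by
    have h := hgJ A (J B)
    rw [hJ, map_neg] at h
    linarith
  have swap : ∀ A B : V, g A (J B) = -g B (J A) := fun A B => by
    rw [hsymm, skew]
  have self : ∀ A : V, g A (J A) = 0 := fun A => by linarith [swap A A]
  simp only [Sop, map_add, map_sub, map_smul, map_neg, LinearMap.add_apply, LinearMap.sub_apply,
    LinearMap.smul_apply, LinearMap.neg_apply, smul_eq_mul, hJ, skew, hiso, self,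
    hsymm ξ Z, hsymm Y X, swap ξ Z, swap Y X]
  module
end

section
/- Fix n ∈ ℕ and λ, μ ∈ ℝ. On the real vector space 𝔤 of dimension 2n+5 with basis {A, w₁, w₂, z₁, z₂, x₁, y₁, …, xₙ, yₙ}, writing B := z₂ − A, the skew-symmetric bilinear bracket determined by [A,w₁] = z₂, [A,w₂] = −z₁, [z₁,w₁] = z₁, [z₁,w₂] = z₂ − 2B, [z₂,w₁] = z₂ + 2B, [z₂,w₂] = −z₁, [w₁,w₂] = (μ−λ)B − μz₂, [xₐ,y_b] = −2δ_{ab}B, [w₁,xₐ] = −xₐ, [w₁,yₐ] = −yₐ, [w₂,xₐ] = −yₐ, [w₂,yₐ] = xₐ (a,b = 1,…,n), with all other brackets of basis elements equal to zero, satisfies the Jacobi identity; hence (𝔤, [·,·]) is a Lie algebra. -/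
/-!
The Lie algebra 𝔤 ≅ 𝔲(1) ⊕ ℂ² ⊕ ℂⁿ of infinitesimal isometries associated to a
strongly degenerate homogeneous pseudo-Kähler structure of linear type.

Basis convention on `LieBas n = Fin 5 ⊕ Fin n × Fin 2`:
`Sum.inl 0 = A`, `Sum.inl 1 = w₁`, `Sum.inl 2 = w₂`, `Sum.inl 3 = z₁`,
`Sum.inl 4 = z₂`, `Sum.inr (a, 0) = xₐ`, `Sum.inr (a, 1) = yₐ`;
the underlying vector space is `LieG n = LieBas n → ℝ` and `Bv = z₂ − A`.
-/

abbrev LieBas (n : ℕ) := Fin 5 ⊕ Fin n × Fin 2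

abbrev LieG (n : ℕ) := LieBas n → ℝ

noncomputable def bas (n : ℕ) (i : LieBas n) : LieG n := Pi.single i 1

noncomputable def Bv (n : ℕ) : LieG n := bas n (.inl 4) - bas n (.inl 0)

/-- Brackets of basis elements. -/
noncomputable def cb (n : ℕ) (lam mu : ℝ) : LieBas n → LieBas n → LieG n
  | .inl 0, .inl 1 => bas n (.inl 4)
  | .inl 1, .inl 0 => -bas n (.inl 4)
  | .inl 0, .inl 2 => -bas n (.inl 3)
  | .inl 2, .inl 0 => bas n (.inl 3)
  | .inl 3, .inl 1 => bas n (.inl 3)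
  | .inl 1, .inl 3 => -bas n (.inl 3)
  | .inl 3, .inl 2 => bas n (.inl 4) - (2 : ℝ) • Bv n
  | .inl 2, .inl 3 => -(bas n (.inl 4) - (2 : ℝ) • Bv n)
  | .inl 4, .inl 1 => bas n (.inl 4) + (2 : ℝ) • Bv n
  | .inl 1, .inl 4 => -(bas n (.inl 4) + (2 : ℝ) • Bv n)
  | .inl 4, .inl 2 => -bas n (.inl 3)
  | .inl 2, .inl 4 => bas n (.inl 3)
  | .inl 1, .inl 2 => (mu - lam) • Bv n - mu • bas n (.inl 4)
  | .inl 2, .inl 1 => -((mu - lam) • Bv n - mu • bas n (.inl 4))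
  | .inr (a, 0), .inr (b, 1) => if a = b then (-2 : ℝ) • Bv n else 0
  | .inr (a, 1), .inr (b, 0) => if a = b then (2 : ℝ) • Bv n else 0
  | .inl 1, .inr (a, 0) => -bas n (.inr (a, 0))
  | .inr (a, 0), .inl 1 => bas n (.inr (a, 0))
  | .inl 1, .inr (a, 1) => -bas n (.inr (a, 1))
  | .inr (a, 1), .inl 1 => bas n (.inr (a, 1))
  | .inl 2, .inr (a, 0) => -bas n (.inr (a, 1))
  | .inr (a, 0), .inl 2 => bas n (.inr (a, 1))
  | .inl 2, .inr (a, 1) => bas n (.inr (a, 0))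
  | .inr (a, 1), .inl 2 => -bas n (.inr (a, 0))
  | _, _ => 0

/-- The bilinear extension of the bracket of basis elements. -/
noncomputable def br (n : ℕ) (lam mu : ℝ) (f g : LieG n) : LieG n :=
  ∑ i : LieBas n, ∑ j : LieBas n, (f i * g j) • cb n lam mu i j

/-- The symplectic pairing on the `ℂⁿ` summand. -/
noncomputable def symplecticPairing (n : ℕ) (f g : LieG n) : ℝ :=
  ∑ a : Fin n, (f (.inr (a, 0)) * g (.inr (a, 1)) - f (.inr (a, 1)) * g (.inr (a, 0)))

/-- The Euclidean pairing on the `ℂⁿ` summand. -/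
noncomputable def euclideanPairing (n : ℕ) (f g : LieG n) : ℝ :=
  ∑ a : Fin n, (f (.inr (a, 0)) * g (.inr (a, 0)) + f (.inr (a, 1)) * g (.inr (a, 1)))

theorem symplecticPairing_swap (n : ℕ) (f g : LieG n) :
    symplecticPairing n f g = -symplecticPairing n g f := by
  simp only [symplecticPairing, ← Finset.sum_neg_distrib]
  exact Finset.sum_congr rfl fun a _ => by ring

theorem euclideanPairing_comm (n : ℕ) (f g : LieG n) :
    euclideanPairing n f g = euclideanPairing n g f :=
  Finset.sum_congr rfl fun a _ => by ring

section coordinates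

variable (n : ℕ) (lam mu : ℝ) (f g h : LieG n)

set_option maxHeartbeats 4000000 in
theorem br_eq : br n lam mu f g =
    (f (.inl 0) * g (.inl 1) - f (.inl 1) * g (.inl 0)) • bas n (.inl 4)
    - (f (.inl 0) * g (.inl 2) - f (.inl 2) * g (.inl 0)) • bas n (.inl 3)
    + (f (.inl 3) * g (.inl 1) - f (.inl 1) * g (.inl 3)) • bas n (.inl 3)
    + (f (.inl 3) * g (.inl 2) - f (.inl 2) * g (.inl 3)) • (bas n (.inl 4) - (2 : ℝ) • Bv n)
    + (f (.inl 4) * g (.inl 1) - f (.inl 1) * g (.inl 4)) • (bas n (.inl 4) + (2 : ℝ) • Bv n)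
    - (f (.inl 4) * g (.inl 2) - f (.inl 2) * g (.inl 4)) • bas n (.inl 3)
    + (f (.inl 1) * g (.inl 2) - f (.inl 2) * g (.inl 1)) •
        ((mu - lam) • Bv n - mu • bas n (.inl 4))
    - (2 * symplecticPairing n f g) • Bv n
    + ∑ a : Fin n,
        ((f (.inr (a, 0)) * g (.inl 1) - f (.inl 1) * g (.inr (a, 0))
          + f (.inl 2) * g (.inr (a, 1)) - f (.inr (a, 1)) * g (.inl 2)) • bas n (.inr (a, 0))
        + (f (.inr (a, 1)) * g (.inl 1) - f (.inl 1) * g (.inr (a, 1))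
          + f (.inr (a, 0)) * g (.inl 2) - f (.inl 2) * g (.inr (a, 0))) •
            bas n (.inr (a, 1))) := by
  simp only [br, symplecticPairing, Fintype.sum_sum_type, Fintype.sum_prod_type, Fin.sum_univ_five,
    Fin.sum_univ_two, cb, smul_ite, smul_zero, Finset.sum_add_distrib, Finset.sum_ite_eq,
    Finset.mem_univ, if_true, Finset.sum_const_zero, add_zero, zero_add, Finset.mul_sum,
    Finset.sum_smul, add_smul, sub_smul, mul_sub, Finset.sum_sub_distrib, smul_neg,
    Finset.sum_neg_distrib, smul_smul]
  simp only [← Finset.sum_smul, ← Finset.mul_sum, ← Finset.sum_mul]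
  module

theorem br_A : br n lam mu f g (.inl 0) =
    2 * (f (.inl 3) * g (.inl 2) - f (.inl 2) * g (.inl 3))
    - 2 * (f (.inl 4) * g (.inl 1) - f (.inl 1) * g (.inl 4))
    - (mu - lam) * (f (.inl 1) * g (.inl 2) - f (.inl 2) * g (.inl 1))
    + 2 * symplecticPairing n f g := by
  simp [br_eq, bas, Bv, Finset.sum_apply]
  ring

theorem br_w₁ : br n lam mu f g (.inl 1) = 0 := by
  simp [br_eq, bas, Bv, Finset.sum_apply]

theorem br_w₂ : br n lam mu f g (.inl 2) = 0 := by
  simp [br_eq, bas, Bv, Finset.sum_apply]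

theorem br_z₁ : br n lam mu f g (.inl 3) =
    -(f (.inl 0) * g (.inl 2) - f (.inl 2) * g (.inl 0))
    + (f (.inl 3) * g (.inl 1) - f (.inl 1) * g (.inl 3))
    - (f (.inl 4) * g (.inl 2) - f (.inl 2) * g (.inl 4)) := by
  simp [br_eq, bas, Bv, Finset.sum_apply]

theorem br_z₂ : br n lam mu f g (.inl 4) =
    (f (.inl 0) * g (.inl 1) - f (.inl 1) * g (.inl 0))
    - (f (.inl 3) * g (.inl 2) - f (.inl 2) * g (.inl 3))
    + 3 * (f (.inl 4) * g (.inl 1) - f (.inl 1) * g (.inl 4))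
    - lam * (f (.inl 1) * g (.inl 2) - f (.inl 2) * g (.inl 1))
    - 2 * symplecticPairing n f g := by
  simp [br_eq, bas, Bv, Finset.sum_apply]
  ring

theorem br_x (a : Fin n) : br n lam mu f g (.inr (a, 0)) =
    f (.inr (a, 0)) * g (.inl 1) - f (.inl 1) * g (.inr (a, 0))
      + f (.inl 2) * g (.inr (a, 1)) - f (.inr (a, 1)) * g (.inl 2) := by
  simp [br_eq, bas, Bv, Finset.sum_apply, Pi.single_apply]

theorem br_y (a : Fin n) : br n lam mu f g (.inr (a, 1)) =
    f (.inr (a, 1)) * g (.inl 1) - f (.inl 1) * g (.inr (a, 1))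
      + f (.inr (a, 0)) * g (.inl 2) - f (.inl 2) * g (.inr (a, 0)) := by
  simp [br_eq, bas, Bv, Finset.sum_apply, Pi.single_apply]

theorem symplecticPairing_br : symplecticPairing n f (br n lam mu g h) =
    h (.inl 1) * symplecticPairing n f g - g (.inl 1) * symplecticPairing n f h
      + h (.inl 2) * euclideanPairing n f g - g (.inl 2) * euclideanPairing n f h := by
  simp only [symplecticPairing, euclideanPairing, br_x, br_y, Finset.mul_sum,
    ← Finset.sum_sub_distrib, ← Finset.sum_add_distrib]
  exact Finset.sum_congr rfl fun a _ => by ring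

theorem br_skew : br n lam mu f g = -br n lam mu g f := by
  have hs := symplecticPairing_swap n f g
  ext i
  rw [Pi.neg_apply]
  rcases i with i | ⟨a, i⟩ <;> fin_cases i <;>
    simp only [Fin.reduceFinMk, Fin.zero_eta, Fin.mk_one, br_A, br_w₁, br_w₂, br_z₁, br_z₂, br_x,
      br_y, hs] <;> ring

theorem br_jacobi : br n lam mu f (br n lam mu g h) + br n lam mu g (br n lam mu h f) +
    br n lam mu h (br n lam mu f g) = 0 := by
  have hfg := symplecticPairing_swap n g f
  have hgh := symplecticPairing_swap n h g
  have hhf := symplecticPairing_swap n f h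
  have efg := euclideanPairing_comm n g f
  have egh := euclideanPairing_comm n h g
  have ehf := euclideanPairing_comm n f h
  ext i
  simp only [Pi.add_apply, Pi.zero_apply]
  rcases i with i | ⟨a, i⟩ <;> fin_cases i <;>
    simp only [Fin.reduceFinMk, Fin.zero_eta, Fin.mk_one, br_A, br_w₁, br_w₂, br_z₁, br_z₂, br_x,
      br_y, symplecticPairing_br, hfg, hgh, hhf, efg, egh, ehf] <;> ring

end coordinates

/-- The bracket is skew-symmetric and satisfies the Jacobi identity, hence
`(𝔤, [·,·])` is a Lie algebra. -/
theorem lie_algebra_g_jacobi (n : ℕ) (lam mu : ℝ) :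
    (∀ f g : LieG n, br n lam mu f g = -br n lam mu g f) ∧
    (∀ f g h : LieG n,
      br n lam mu f (br n lam mu g h) + br n lam mu g (br n lam mu h f) +
        br n lam mu h (br n lam mu f g) = 0) := by
  exact ⟨br_skew n lam mu, br_jacobi n lam mu⟩
end

section
/- Fix n ∈ ℕ and λ, μ ∈ ℝ, and let 𝔤 be the (2n+5)-dimensional real Lie algebra with basis {A, w₁, w₂, z₁, z₂, x₁, y₁, …, xₙ, yₙ}, B := z₂ − A, and nonzero brackets [A,w₁] = z₂, [A,w₂] = −z₁, [z₁,w₁] = z₁, [z₁,w₂] = z₂ − 2B, [z₂,w₁] = z₂ + 2B, [z₂,w₂] = −z₁, [w₁,w₂] = (μ−λ)B − μz₂, [xₐ,y_b] = −2δ_{ab}B, [w₁,xₐ] = −xₐ, [w₁,yₐ] = −yₐ, [w₂,xₐ] = −yₐ, [w₂,yₐ] = xₐ. Then 𝔤 is a solvable Lie algebra: its derived algebra [𝔤,𝔤] is contained in span{A, z₁, z₂, x₁, y₁, …, xₙ, yₙ}, the second derived algebra is contained in ℝB, and the third derived algebra is zero. -/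
/-- The span of the basis elements A, z₁, z₂, x₁, y₁, …, xₙ, yₙ
(all basis elements except w₁ and w₂). -/
noncomputable def nilSpan (n : ℕ) : Submodule ℝ (LieG n) :=
  Submodule.span ℝ
    {v : LieG n | ∃ i : LieBas n, i ≠ Sum.inl 1 ∧ i ≠ Sum.inl 2 ∧ v = bas n i}

/-- The derived algebra [𝔤,𝔤]. -/
noncomputable def derived1 (n : ℕ) (lam mu : ℝ) : Submodule ℝ (LieG n) :=
  Submodule.span ℝ {v : LieG n | ∃ f g : LieG n, v = br n lam mu f g}

/-- The second derived algebra [[𝔤,𝔤],[𝔤,𝔤]]. -/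
noncomputable def derived2 (n : ℕ) (lam mu : ℝ) : Submodule ℝ (LieG n) :=
  Submodule.span ℝ {v : LieG n | ∃ f ∈ derived1 n lam mu, ∃ g ∈ derived1 n lam mu,
    v = br n lam mu f g}

/-- The third derived algebra. -/
noncomputable def derived3 (n : ℕ) (lam mu : ℝ) : Submodule ℝ (LieG n) :=
  Submodule.span ℝ {v : LieG n | ∃ f ∈ derived2 n lam mu, ∃ g ∈ derived2 n lam mu,
    v = br n lam mu f g}

theorem bas_mem_nilSpan {n : ℕ} {i : LieBas n} (h₁ : i ≠ .inl 1) (h₂ : i ≠ .inl 2) :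
    bas n i ∈ nilSpan n :=
  Submodule.subset_span ⟨i, h₁, h₂, rfl⟩

theorem Bv_mem_nilSpan (n : ℕ) : Bv n ∈ nilSpan n :=
  sub_mem (bas_mem_nilSpan (by simp) (by simp)) (bas_mem_nilSpan (by simp) (by simp))

theorem cb_mem_nilSpan (n : ℕ) (lam mu : ℝ) (i j : LieBas n) :
    cb n lam mu i j ∈ nilSpan n := by
  have hB := Bv_mem_nilSpan n
  have h₃ : bas n (.inl 3) ∈ nilSpan n := bas_mem_nilSpan (by simp) (by simp)
  have h₄ : bas n (.inl 4) ∈ nilSpan n := bas_mem_nilSpan (by simp) (by simp)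
  have hr (p : Fin n × Fin 2) : bas n (.inr p) ∈ nilSpan n :=
    bas_mem_nilSpan (by simp) (by simp)
  have hs (c : ℝ) : c • Bv n ∈ nilSpan n := Submodule.smul_mem _ c hB
  have hs₄ (c : ℝ) : c • bas n (.inl 4) ∈ nilSpan n := Submodule.smul_mem _ c h₄
  unfold cb
  split <;> (try split_ifs) <;>
    first
    | exact zero_mem _
    | apply_assumption
    | exact neg_mem (by apply_assumption)
    | exact sub_mem (by apply_assumption) (by apply_assumption)
    | exact add_mem (by apply_assumption) (by apply_assumption)
    | exact neg_mem (sub_mem (by apply_assumption) (by apply_assumption))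
    | exact neg_mem (add_mem (by apply_assumption) (by apply_assumption))

theorem cb_mem_span_Bv {n : ℕ} (lam mu : ℝ) {i j : LieBas n}
    (hi₁ : i ≠ .inl 1) (hi₂ : i ≠ .inl 2) (hj₁ : j ≠ .inl 1) (hj₂ : j ≠ .inl 2) :
    cb n lam mu i j ∈ Submodule.span ℝ {Bv n} := by
  have hs (c : ℝ) : c • Bv n ∈ Submodule.span ℝ {Bv n} :=
    Submodule.smul_mem _ c (Submodule.mem_span_singleton_self _)
  unfold cb
  split <;> (try split_ifs) <;>
    first
    | exact zero_mem _
    | exact hs _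
    | exact absurd rfl ‹_›

theorem apply_eq_zero_of_mem_nilSpan {n : ℕ} {f : LieG n} (hf : f ∈ nilSpan n)
    {i : LieBas n} (hi : i = .inl 1 ∨ i = .inl 2) : f i = 0 := by
  have hle : nilSpan n ≤ LinearMap.ker (LinearMap.proj (R := ℝ) (φ := fun _ => ℝ) i) := by
    refine Submodule.span_le.2 ?_
    rintro _ ⟨k, hk₁, hk₂, rfl⟩
    rcases hi with rfl | rfl
    · simp [bas, hk₁.symm]
    · simp [bas, hk₂.symm]
  exact hle hf

theorem br_mem_nilSpan (n : ℕ) (lam mu : ℝ) (f g : LieG n) : br n lam mu f g ∈ nilSpan n :=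
  sum_mem fun i _ => sum_mem fun j _ => Submodule.smul_mem _ _ (cb_mem_nilSpan n lam mu i j)

theorem br_mem_span_Bv {n : ℕ} (lam mu : ℝ) {f g : LieG n} (hf : f ∈ nilSpan n)
    (hg : g ∈ nilSpan n) : br n lam mu f g ∈ Submodule.span ℝ {Bv n} := by
  refine sum_mem fun i _ => sum_mem fun j _ => ?_
  by_cases hi : i = .inl 1 ∨ i = .inl 2
  · simp [apply_eq_zero_of_mem_nilSpan hf hi]
  by_cases hj : j = .inl 1 ∨ j = .inl 2
  · simp [apply_eq_zero_of_mem_nilSpan hg hj]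
  rw [not_or] at hi hj
  exact Submodule.smul_mem _ _ (cb_mem_span_Bv lam mu hi.1 hi.2 hj.1 hj.2)

theorem br_smul_Bv_smul_Bv (n : ℕ) (lam mu a b : ℝ) :
    br n lam mu (a • Bv n) (b • Bv n) = 0 := by
  have hsupp {k : LieBas n} (h₀ : k ≠ .inl 0) (h₄ : k ≠ .inl 4) : Bv n k = 0 := by
    simp [Bv, bas, Pi.single_eq_of_ne h₀, Pi.single_eq_of_ne h₄]
  refine Finset.sum_eq_zero fun i _ => Finset.sum_eq_zero fun j _ => ?_
  by_cases hi : i = .inl 0 ∨ i = .inl 4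
  · by_cases hj : j = .inl 0 ∨ j = .inl 4
    · have hc : cb n lam mu i j = 0 := by
        rcases hi with rfl | rfl <;> rcases hj with rfl | rfl <;> rfl
      rw [hc, smul_zero]
    · rw [not_or] at hj
      simp [hsupp hj.1 hj.2]
  · rw [not_or] at hi
    simp [hsupp hi.1 hi.2]

/-- 𝔤 is solvable: [𝔤,𝔤] ⊆ span{A, z₁, z₂, xₐ, yₐ}, the second derived algebra
is contained in ℝB, and the third derived algebra is zero. -/
theorem lie_algebra_g_solvable (n : ℕ) (lam mu : ℝ) :
    derived1 n lam mu ≤ nilSpan n ∧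
    derived2 n lam mu ≤ Submodule.span ℝ {Bv n} ∧
    derived3 n lam mu = ⊥ := by
  have h₁ : derived1 n lam mu ≤ nilSpan n := by
    refine Submodule.span_le.2 ?_
    rintro _ ⟨f, g, rfl⟩
    exact br_mem_nilSpan n lam mu f g
  have h₂ : derived2 n lam mu ≤ Submodule.span ℝ {Bv n} := by
    refine Submodule.span_le.2 ?_
    rintro _ ⟨f, hf, g, hg, rfl⟩
    exact br_mem_span_Bv lam mu (h₁ hf) (h₁ hg)
  refine ⟨h₁, h₂, Submodule.span_eq_bot.2 ?_⟩
  rintro _ ⟨f, hf, g, hg, rfl⟩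
  obtain ⟨a, rfl⟩ := Submodule.mem_span_singleton.1 (h₂ hf)
  obtain ⟨b, rfl⟩ := Submodule.mem_span_singleton.1 (h₂ hg)
  exact br_smul_Bv_smul_Bv n lam mu a b
end
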